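/- arXiv:2208.07803 — 2 statements merged into one kernel-verified Lean document; each statement's English description precedes it below -/
import Mathlib

section
/- Assume n ≥ 3. In U(ŝl_{n+1}) the quantum Serre relation e_r^{(2)} Ĕ_{r−1} − e_r Ĕ_{r−1} e_r + Ĕ_{r−1} e_r^{(2)} = 0 holds, where e_r^{(2)} = e_r²/[2]!. -/
noncomputable section

/-- The field ℚ(v) of rational functions over ℚ. -/
abbrev Qv : Type := RatFunc ℚ

/-- The indeterminate v. -/
def vv : Qv := RatFunc.X

/-- The quantum integer [a] = (v^a - v^{-a})/(v - v⁻¹). -/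
def qint (a : ℕ) : Qv := (vv ^ (a : ℤ) - vv ^ (-(a : ℤ))) / (vv - vv⁻¹)

/-- The quantum factorial [a]! = [a][a-1]⋯[1]. -/
def qfact : ℕ → Qv
  | 0 => 1
  | n + 1 => qint (n + 1) * qfact n

/-- Divided power x^{(p)} = x^p / [p]!. -/
def dp {A : Type} [Ring A] [Algebra Qv A] (x : A) (p : ℕ) : A :=
  (qfact p)⁻¹ • x ^ p

/-- The affine type A Cartan matrix entries c_{ij} = 2δ_{i,j} - δ_{i,j+1} - δ_{i,j-1}. -/
def cartan {m : ℕ} (i j : ZMod m) : ℤ :=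
  (if i = j then 2 else 0) - (if i = j + 1 then 1 else 0) - (if i = j - 1 then 1 else 0)

/-- Generators of the quantum affine algebra U(ŝl_m). -/
inductive Gen (m : ℕ) : Type
  | E : ZMod m → Gen m
  | F : ZMod m → Gen m
  | K : ZMod m → Gen m
  | Kinv : ZMod m → Gen m

abbrev FA (m : ℕ) := FreeAlgebra Qv (Gen m)

def fE {m : ℕ} (i : ZMod m) : FA m := FreeAlgebra.ι Qv (Gen.E i)
def fF {m : ℕ} (i : ZMod m) : FA m := FreeAlgebra.ι Qv (Gen.F i)
def fK {m : ℕ} (i : ZMod m) : FA m := FreeAlgebra.ι Qv (Gen.K i)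
def fKinv {m : ℕ} (i : ZMod m) : FA m := FreeAlgebra.ι Qv (Gen.Kinv i)

/-- The defining relations of the quantum affine algebra U(ŝl_m). -/
inductive URel (m : ℕ) : FA m → FA m → Prop
  | KK : ∀ i j, URel m (fK i * fK j) (fK j * fK i)
  | KKinv : ∀ i, URel m (fK i * fKinv i) 1
  | KinvK : ∀ i, URel m (fKinv i * fK i) 1
  | KE : ∀ i j, URel m (fK i * fE j) (vv ^ cartan i j • (fE j * fK i))
  | KF : ∀ i j, URel m (fK i * fF j) (vv ^ (-cartan i j) • (fF j * fK i))
  | EF : ∀ i j, URel m (fE i * fF j - fF j * fE i)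
      (if i = j then (vv - vv⁻¹)⁻¹ • (fK i - fKinv i) else 0)
  | serreE : ∀ i j, i ≠ j →
      URel m (∑ p ∈ Finset.range ((1 - cartan i j).toNat + 1),
        ((-1 : Qv) ^ p) • (dp (fE i) p * fE j * dp (fE i) ((1 - cartan i j).toNat - p))) 0
  | serreF : ∀ i j, i ≠ j →
      URel m (∑ p ∈ Finset.range ((1 - cartan i j).toNat + 1),
        ((-1 : Qv) ^ p) • (dp (fF i) p * fF j * dp (fF i) ((1 - cartan i j).toNat - p))) 0

/-- The quantum affine algebra U(ŝl_m), presented by generators and relations. -/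
abbrev U (m : ℕ) := RingQuot (URel m)

def UE {m : ℕ} (i : ZMod m) : U m := RingQuot.mkAlgHom Qv (URel m) (fE i)
def UF {m : ℕ} (i : ZMod m) : U m := RingQuot.mkAlgHom Qv (URel m) (fF i)
def UK {m : ℕ} (i : ZMod m) : U m := RingQuot.mkAlgHom Qv (URel m) (fK i)
def UKinv {m : ℕ} (i : ZMod m) : U m := RingQuot.mkAlgHom Qv (URel m) (fKinv i)

/-- The element e_r = Ĕ_r Ĕ_{r+1} − v^ε Ĕ_{r+1} Ĕ_r in U(ŝl_{n+1}). -/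
def er (n r : ℕ) (ε : ℤ) : U (n + 1) :=
  UE (r : ZMod (n + 1)) * UE ((r : ZMod (n + 1)) + 1) -
    vv ^ ε • (UE ((r : ZMod (n + 1)) + 1) * UE (r : ZMod (n + 1)))

/-- The element f_r = F̆_{r+1} F̆_r − v^{−ε} F̆_r F̆_{r+1} in U(ŝl_{n+1}). -/
def fr (n r : ℕ) (ε : ℤ) : U (n + 1) :=
  UF ((r : ZMod (n + 1)) + 1) * UF (r : ZMod (n + 1)) -
    vv ^ (-ε) • (UF (r : ZMod (n + 1)) * UF ((r : ZMod (n + 1)) + 1))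

/-- The element k_r = K̆_r K̆_{r+1} in U(ŝl_{n+1}). -/
def kr (n r : ℕ) : U (n + 1) :=
  UK (r : ZMod (n + 1)) * UK ((r : ZMod (n + 1)) + 1)

/-- The image e_i ∈ U(ŝl_{n+1}) of the generator E_i, i ∈ ℤ/nℤ. -/
def eElt (n r : ℕ) (ε : ℤ) (i : ZMod n) : U (n + 1) :=
  if i.val < r then UE ((i.val : ZMod (n + 1)))
  else if i.val = r then er n r ε
  else UE ((i.val + 1 : ℕ) : ZMod (n + 1))

def fElt (n r : ℕ) (ε : ℤ) (i : ZMod n) : U (n + 1) :=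
  if i.val < r then UF ((i.val : ZMod (n + 1)))
  else if i.val = r then fr n r ε
  else UF ((i.val + 1 : ℕ) : ZMod (n + 1))

def kElt (n r : ℕ) (i : ZMod n) : U (n + 1) :=
  if i.val < r then UK ((i.val : ZMod (n + 1)))
  else if i.val = r then kr n r
  else UK ((i.val + 1 : ℕ) : ZMod (n + 1))

def kinvElt (n r : ℕ) (i : ZMod n) : U (n + 1) :=
  if i.val < r then UKinv ((i.val : ZMod (n + 1)))
  else if i.val = r then UKinv (r : ZMod (n + 1)) * UKinv ((r : ZMod (n + 1)) + 1)
  else UKinv ((i.val + 1 : ℕ) : ZMod (n + 1))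


/-- If `B` satisfies the quadratic quantum Serre relation with `A`, `C` satisfies it with `B`, and
`A` commutes with `C`, then the `t`-commutator `x` of `B` and `C` satisfies it with `A`. -/
theorem serre_of_qcommutator {k R : Type*} [Field k] [Ring R] [Algebra k R] {t : k} (ht : t ≠ 0)
    (hq : t + t⁻¹ ≠ 0) {A B C x : R} (hx : x = B * C - t • (C * B)) (hAC : A * C = C * A)
    (hBA : B * B * A - (t + t⁻¹) • (B * A * B) + A * B * B = 0)
    (hBC : B * B * C - (t + t⁻¹) • (B * C * B) + C * B * B = 0)
    (hCB : C * C * B - (t + t⁻¹) • (C * B * C) + B * C * C = 0) :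
    x * x * A - (t + t⁻¹) • (x * A * x) + A * x * x = 0 := by
  have xC : x * C = t⁻¹ • (C * x) := by
    subst hx
    simp only [mul_sub, sub_mul, smul_mul_assoc, mul_smul_comm, mul_assoc] at hCB ⊢
    linear_combination (norm := skip) hCB
    match_scalars <;> field_simp <;> ring
  have xB : x * B = t • (B * x) := by
    subst hx
    simp only [mul_sub, sub_mul, smul_mul_assoc, mul_smul_comm, mul_assoc] at hBC ⊢
    linear_combination (norm := skip) (-t) • hBC
    match_scalars <;> field_simp <;> ring
  have BC : B * C = x + t • (C * B) := by rw [hx]; abel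
  have AC' (z : R) : A * (C * z) = C * (A * z) := by rw [← mul_assoc, hAC, mul_assoc]
  have BC' (z : R) : B * (C * z) = x * z + t • (C * (B * z)) := by
    rw [← mul_assoc, BC, add_mul, smul_mul_assoc, mul_assoc]
  have xC' (z : R) : x * (C * z) = t⁻¹ • (C * (x * z)) := by
    rw [← mul_assoc, xC, smul_mul_assoc, mul_assoc]
  have xB' (z : R) : x * (B * z) = t • (B * (x * z)) := by
    rw [← mul_assoc, xB, smul_mul_assoc, mul_assoc]
  have key : B * x * A + A * B * x - t⁻¹ • (B * A * x) - x * A * B = 0 := by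
    have h : (B * B * A - (t + t⁻¹) • (B * A * B) + A * B * B) * C
        - t ^ 2 • (C * (B * B * A - (t + t⁻¹) • (B * A * B) + A * B * B)) = 0 := by
      simp [hBA]
    apply (smul_eq_zero_iff_right (mul_ne_zero ht hq)).1
    simp only [mul_sub, sub_mul, mul_add, add_mul, smul_mul_assoc, mul_smul_comm, mul_assoc,
      hAC, AC', BC, BC', xB, xB', smul_add, smul_sub, smul_smul] at h ⊢
    linear_combination (norm := skip) h
    match_scalars <;> field_simp <;> ring
  have h : (B * x * A + A * B * x - t⁻¹ • (B * A * x) - x * A * B) * C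
      - C * (B * x * A + A * B * x - t⁻¹ • (B * A * x) - x * A * B) = 0 := by
    simp [key]
  simp only [mul_sub, sub_mul, mul_add, add_mul, smul_mul_assoc, mul_smul_comm, mul_assoc,
    hAC, AC', BC, BC', xC, xC', smul_add, smul_smul] at h ⊢
  linear_combination (norm := skip) t • h
  match_scalars <;> field_simp <;> ring

theorem vv_ne_zero : vv ≠ 0 := RatFunc.X_ne_zero

theorem vv_sq_ne_C (c : ℚ) : vv ^ 2 ≠ RatFunc.C c := by
  intro h
  have h' : algebraMap (Polynomial ℚ) (RatFunc ℚ) (Polynomial.X ^ 2)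
      = algebraMap (Polynomial ℚ) (RatFunc ℚ) (Polynomial.C c) := by
    rw [map_pow, RatFunc.algebraMap_X, RatFunc.algebraMap_C]
    exact h
  have h2 := congrArg Polynomial.natDegree (RatFunc.algebraMap_injective ℚ h')
  simp at h2

theorem vv_add_inv_ne_zero : vv + vv⁻¹ ≠ 0 := by
  intro h
  apply vv_sq_ne_C (-1)
  have := vv_ne_zero
  field_simp at h
  rw [map_neg, map_one]
  linear_combination h

theorem vv_sub_inv_ne_zero : vv - vv⁻¹ ≠ 0 := by
  intro h
  apply vv_sq_ne_C 1
  have := vv_ne_zero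
  field_simp at h
  rw [map_one]
  linear_combination h

theorem qfact_zero : qfact 0 = 1 := rfl

theorem qfact_one : qfact 1 = 1 := by
  simp [qfact, qint, div_self vv_sub_inv_ne_zero]

theorem qfact_two : qfact 2 = vv + vv⁻¹ := by
  have h : qfact 2 = qint 2 * qfact 1 := rfl
  rw [h, qfact_one, mul_one, qint, div_eq_iff vv_sub_inv_ne_zero]
  have := vv_ne_zero
  simp only [zpow_neg, zpow_natCast]
  field_simp
  ring

theorem dp_zero {A : Type} [Ring A] [Algebra Qv A] (x : A) : dp x 0 = 1 := by
  simp [dp, qfact_zero]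

theorem dp_one {A : Type} [Ring A] [Algebra Qv A] (x : A) : dp x 1 = x := by
  simp [dp, qfact_one]

theorem dp_two {A : Type} [Ring A] [Algebra Qv A] (x : A) :
    dp x 2 = (vv + vv⁻¹)⁻¹ • (x * x) := by
  rw [dp, qfact_two, pow_two]

theorem dp_two_serre {A : Type} [Ring A] [Algebra Qv A] (x y : A) :
    dp x 2 * y - x * y * x + y * dp x 2
      = (vv + vv⁻¹)⁻¹ • (x * x * y - (vv + vv⁻¹) • (x * y * x) + y * x * x) := by
  have hq := vv_add_inv_ne_zero
  rw [smul_add, smul_sub, inv_smul_smul₀ hq, dp_two, smul_mul_assoc, mul_smul_comm, mul_assoc y]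

theorem sum_dp_two {A : Type} [Ring A] [Algebra Qv A] (x y : A) :
    ∑ p ∈ Finset.range (2 + 1), ((-1 : Qv) ^ p) • (dp x p * y * dp x (2 - p))
      = (vv + vv⁻¹)⁻¹ • (x * x * y - (vv + vv⁻¹) • (x * y * x) + y * x * x) := by
  rw [← dp_two_serre]
  simp [Finset.sum_range_succ, dp_zero, dp_one]
  abel

theorem map_dp {A B : Type} [Ring A] [Algebra Qv A] [Ring B] [Algebra Qv B] (f : A →ₐ[Qv] B)
    (x : A) (p : ℕ) : f (dp x p) = dp (f x) p := by
  simp [dp]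

theorem UE_serre {m : ℕ} {i j : ZMod m} (hij : i ≠ j) :
    ∑ p ∈ Finset.range ((1 - cartan i j).toNat + 1),
      ((-1 : Qv) ^ p) • (dp (UE i) p * UE j * dp (UE i) ((1 - cartan i j).toNat - p)) = 0 := by
  have h := RingQuot.mkAlgHom_rel Qv (URel.serreE i j hij)
  simp only [map_sum, map_smul, map_mul, map_dp, map_zero] at h
  exact h

theorem UE_mul_comm {m : ℕ} {i j : ZMod m} (hij : i ≠ j) (hc : cartan i j = 0) :
    UE i * UE j = UE j * UE i := by
  have h := UE_serre hij
  rw [hc] at h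
  simp only [sub_zero, Int.toNat_one, Finset.sum_range_succ, Finset.sum_range_zero, dp_zero,
    dp_one, pow_zero, pow_one, one_smul, one_mul, mul_one, zero_add, Nat.sub_zero,
    Nat.sub_self] at h
  exact (eq_of_sub_eq_zero (by rw [sub_eq_add_neg]; exact h)).symm

theorem UE_serre_quadratic {m : ℕ} {i j : ZMod m} (hij : i ≠ j) (hc : cartan i j = -1) :
    UE i * UE i * UE j - (vv + vv⁻¹) • (UE i * UE j * UE i) + UE j * UE i * UE i = 0 := by
  have h := UE_serre hij
  have h2 : (1 - cartan i j).toNat = 2 := by rw [hc]; rfl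
  rw [h2] at h
  rw [sum_dp_two] at h
  exact (smul_eq_zero_iff_right (inv_ne_zero vv_add_inv_ne_zero)).1 h

theorem ZMod.natCast_ne_zero_of_lt {m a : ℕ} (ha : a ≠ 0) (h : a < m) : (a : ZMod m) ≠ 0 := by
  rw [Ne, ZMod.natCast_eq_zero_iff]
  exact Nat.not_dvd_of_pos_of_lt (Nat.pos_of_ne_zero ha) h

theorem cartan_self_add_one {m : ℕ} (hm : 3 ≤ m) (i : ZMod m) : cartan i (i + 1) = -1 := by
  have h1 : (1 : ZMod m) ≠ 0 := by
    exact_mod_cast ZMod.natCast_ne_zero_of_lt (m := m) one_ne_zero (by omega)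
  have h2 : (1 + 1 : ZMod m) ≠ 0 := by
    exact_mod_cast ZMod.natCast_ne_zero_of_lt (m := m) (a := 1 + 1) (by omega) (by omega)
  simp [cartan, h1, h2, add_assoc]

theorem cartan_comm {m : ℕ} (i j : ZMod m) : cartan i j = cartan j i := by
  simp only [cartan, eq_comm (a := j), sub_eq_iff_eq_add, ← eq_sub_iff_add_eq]
  ring

theorem cartan_sub_one_add_one {m : ℕ} (hm : 4 ≤ m) (i : ZMod m) :
    cartan (i - 1) (i + 1) = 0 := by
  have h1 : (1 : ZMod m) ≠ 0 := by
    exact_mod_cast ZMod.natCast_ne_zero_of_lt (m := m) one_ne_zero (by omega)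
  have h2 : (2 : ZMod m) ≠ 0 := by
    exact_mod_cast ZMod.natCast_ne_zero_of_lt (m := m) two_ne_zero (by omega)
  have h3 : (3 : ZMod m) ≠ 0 := by
    exact_mod_cast ZMod.natCast_ne_zero_of_lt (m := m) three_ne_zero (by omega)
  rw [cartan, if_neg fun h => h2 (by linear_combination -h),
    if_neg fun h => h3 (by linear_combination -h), if_neg fun h => h1 (by linear_combination -h)]
  rfl

/-- For n ≥ 3, the quantum Serre relation e_r^{(2)} Ĕ_{r−1} − e_r Ĕ_{r−1} e_r
+ Ĕ_{r−1} e_r^{(2)} = 0. -/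
theorem serre_er_Erm1
    (n r : ℕ) (hn : 3 ≤ n) (hr : r ≤ n - 1) (ε : ℤ) (hε : ε = 1 ∨ ε = -1) :
    dp (er n r ε) 2 * UE ((r : ZMod (n + 1)) - 1) -
      er n r ε * UE ((r : ZMod (n + 1)) - 1) * er n r ε +
      UE ((r : ZMod (n + 1)) - 1) * dp (er n r ε) 2 = 0 := by
  have hq := vv_add_inv_ne_zero
  have ht : vv ^ ε ≠ 0 := zpow_ne_zero _ vv_ne_zero
  have hqt : vv ^ ε + (vv ^ ε)⁻¹ = vv + vv⁻¹ := by
    rcases hε with rfl | rfl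
    · simp
    · simp [add_comm]
  have h1 : (1 : ZMod (n + 1)) ≠ 0 := by
    exact_mod_cast ZMod.natCast_ne_zero_of_lt (m := n + 1) one_ne_zero (by omega)
  have h2 : (2 : ZMod (n + 1)) ≠ 0 := by
    exact_mod_cast ZMod.natCast_ne_zero_of_lt (m := n + 1) two_ne_zero (by omega)
  generalize hs : (r : ZMod (n + 1)) = s
  have hadd : cartan s (s + 1) = -1 := cartan_self_add_one (by omega) s
  have hsub : cartan (s - 1) s = -1 := by
    have h := cartan_self_add_one (by omega : 3 ≤ n + 1) (s - 1)
    rwa [sub_add_cancel] at h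
  have hAC := UE_mul_comm (fun h => h2 (by linear_combination -h))
    (cartan_sub_one_add_one (by omega) s)
  have hBA := UE_serre_quadratic (i := s) (j := s - 1) (fun h => h1 (by linear_combination h))
    (by rw [cartan_comm, hsub])
  have hBC := UE_serre_quadratic (i := s) (j := s + 1) (fun h => h1 (by linear_combination -h))
    hadd
  have hCB := UE_serre_quadratic (i := s + 1) (j := s) (fun h => h1 (by linear_combination h))
    (by rw [cartan_comm, hadd])
  rw [← hqt] at hq hBA hBC hCB
  have key := serre_of_qcommutator ht hq (x := er n r ε) (by rw [er, hs]) hAC hBA hBC hCB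
  rw [hqt] at key
  rw [dp_two_serre, key, smul_zero]

end
end

section
/- In U(ŝl_3), for pairwise distinct i, j, ℓ ∈ ℤ/3ℤ, the higher-order Serre identity Ĕ_ℓ^{(3)} Ĕ_i Ĕ_j − Ĕ_ℓ^{(2)} Ĕ_i Ĕ_j Ĕ_ℓ + Ĕ_ℓ Ĕ_i Ĕ_j Ĕ_ℓ^{(2)} − Ĕ_i Ĕ_j Ĕ_ℓ^{(3)} = 0 holds, where Ĕ_ℓ^{(p)} = Ĕ_ℓ^p/[p]!. -/
noncomputable section

open Polynomial in
theorem algebraMap_ratFunc_ne_zero (p : ℚ[X]) (hp : p.eval 2 ≠ 0) :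
    algebraMap ℚ[X] Qv p ≠ 0 := by
  refine RatFunc.algebraMap_ne_zero ?_
  rintro rfl
  simp at hp

open Polynomial in
theorem vv_sq_sub_one_ne_zero : vv ^ 2 - 1 ≠ 0 := by
  have h := algebraMap_ratFunc_ne_zero (X ^ 2 - 1) (by norm_num)
  rw [map_sub] at h
  simpa only [vv, map_pow, map_one, RatFunc.algebraMap_X] using h

open Polynomial in
theorem vv_sq_add_one_ne_zero : vv ^ 2 + 1 ≠ 0 := by
  have h := algebraMap_ratFunc_ne_zero (X ^ 2 + 1) (by norm_num)
  rw [map_add] at h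
  simpa only [vv, map_pow, map_one, RatFunc.algebraMap_X] using h

open Polynomial in
theorem vv_pow_four_add_sq_add_one_ne_zero : vv ^ 4 + vv ^ 2 + 1 ≠ 0 := by
  have h := algebraMap_ratFunc_ne_zero (X ^ 4 + X ^ 2 + 1) (by norm_num)
  rw [map_add, map_add] at h
  simpa only [vv, map_pow, map_one, RatFunc.algebraMap_X] using h

theorem qint_one : qint 1 = 1 := by
  simpa [qint] using div_self vv_sub_inv_ne_zero

theorem qint_two : qint 2 = vv + vv⁻¹ := by
  rw [qint, div_eq_iff vv_sub_inv_ne_zero, zpow_neg, zpow_natCast]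
  have := vv_ne_zero
  field_simp
  ring

theorem qint_three : qint 3 = qint 2 ^ 2 - 1 := by
  rw [qint_two, qint, div_eq_iff vv_sub_inv_ne_zero, zpow_neg, zpow_natCast]
  have := vv_ne_zero
  field_simp
  ring

theorem qint_two_ne_zero : qint 2 ≠ 0 := by
  have h : qint 2 = (vv ^ 2 + 1) / vv := by
    have := vv_ne_zero
    rw [qint_two]
    field_simp
  rw [h]
  exact div_ne_zero vv_sq_add_one_ne_zero vv_ne_zero

theorem qint_three_ne_zero : qint 3 ≠ 0 := by
  have h : qint 3 = (vv ^ 4 + vv ^ 2 + 1) / vv ^ 2 := by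
    have := vv_ne_zero
    rw [qint_three, qint_two]
    field_simp
    ring
  rw [h]
  exact div_ne_zero vv_pow_four_add_sq_add_one_ne_zero (pow_ne_zero 2 vv_ne_zero)

theorem qfact_two_s10 : qfact 2 = qint 2 := by
  simp [qfact, qint_one]

theorem qfact_three : qfact 3 = qint 3 * qint 2 := by
  simp [qfact, qint_one]

theorem cartan_of_ne (i j : ZMod 3) (h : i ≠ j) : cartan i j = -1 := by
  revert i j
  decide

/-- The quantum Serre relation between two distinct generators of U(ŝl_3), denominators cleared. -/
theorem serre_UE (i j : ZMod 3) (h : i ≠ j) :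
    UE i ^ 2 * UE j - qint 2 • (UE i * UE j * UE i) + UE j * UE i ^ 2 = 0 := by
  have hs := RingQuot.mkAlgHom_rel Qv (URel.serreE i j h)
  rw [cartan_of_ne i j h] at hs
  have hn : (1 - (-1 : ℤ)).toNat = 2 := rfl
  have h2 := qint_two_ne_zero
  have h0 : qfact 0 = 1 := rfl
  have h1 : qfact 1 = 1 := by simp [qfact, qint_one]
  simp only [hn, Finset.sum_range_succ, Finset.sum_range_zero, dp, qfact_two_s10, h0, h1, map_add,
    map_smul, map_mul, map_pow, map_zero] at hs
  change 0 + _ • (_ • UE i ^ 0 * UE j * _ • UE i ^ 2) + _ • (_ • UE i ^ 1 * UE j * _ • UE i ^ 1) +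
    _ • (_ • UE i ^ 2 * UE j * _ • UE i ^ 0) = 0 at hs
  rw [← smul_zero (qint 2), ← hs]
  simp only [tsub_zero, smul_mul_assoc, mul_smul_comm, smul_add, smul_smul, pow_zero, pow_one,
    one_mul, mul_one, inv_one, zero_add, one_smul]
  rw [qfact_two_s10, mul_inv_cancel₀ h2, one_smul, mul_neg_one, neg_smul,
    show qint 2 * ((-1) ^ 2 * (qint 2)⁻¹) = 1 by field_simp, one_smul]
  abel

/-- If `x` satisfies the quantum Serre relation with both `a` and `b`, then it satisfies
a cubic Serre relation with `a * b`. -/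
theorem cubic_serre {R A : Type*} [CommRing R] [Ring A] [Algebra R A] (c : R) (x a b : A)
    (ha : x ^ 2 * a - c • (x * a * x) + a * x ^ 2 = 0)
    (hb : x ^ 2 * b - c • (x * b * x) + b * x ^ 2 = 0) :
    x ^ 3 * a * b - (c ^ 2 - 1) • (x ^ 2 * a * b * x) + (c ^ 2 - 1) • (x * a * b * x ^ 2) -
      a * b * x ^ 3 = 0 := by
  set s := x ^ 2 * a - c • (x * a * x) + a * x ^ 2 with hs
  set t := x ^ 2 * b - c • (x * b * x) + b * x ^ 2 with ht
  have key : x ^ 3 * a * b - (c ^ 2 - 1) • (x ^ 2 * a * b * x) +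
      (c ^ 2 - 1) • (x * a * b * x ^ 2) - a * b * x ^ 3 =
      x * s * b + c • (s * x * b) - (c ^ 2 - 1) • (s * b * x) +
        (c ^ 2 - 1) • (x * a * t) - c • (a * x * t) - a * t * x := by
    simp only [hs, ht, pow_succ, pow_zero, one_mul, mul_add, add_mul, mul_sub, sub_mul,
      smul_mul_assoc, mul_smul_comm, mul_assoc]
    module
  rw [key, ha, hb]
  simp

/-- In U(ŝl_3), for pairwise distinct i, j, ℓ ∈ ℤ/3ℤ, the higher-order Serre
identity Ĕ_ℓ^{(3)} Ĕ_i Ĕ_j − Ĕ_ℓ^{(2)} Ĕ_i Ĕ_j Ĕ_ℓ + Ĕ_ℓ Ĕ_i Ĕ_j Ĕ_ℓ^{(2)} − Ĕ_i Ĕ_j Ĕ_ℓ^{(3)} = 0. -/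
theorem higher_serre_identity
    (i j l : ZMod 3) (hij : i ≠ j) (hil : i ≠ l) (hjl : j ≠ l) :
    dp (UE l) 3 * UE i * UE j - dp (UE l) 2 * UE i * UE j * UE l +
      UE l * UE i * UE j * dp (UE l) 2 - UE i * UE j * dp (UE l) 3 = 0 := by
  have h := cubic_serre (qint 2) (UE l) (UE i) (UE j) (serre_UE l i hil.symm)
    (serre_UE l j hjl.symm)
  rw [← qint_three] at h
  have h3 := qint_three_ne_zero
  rw [← smul_zero (qint 3 * qint 2)⁻¹, ← h]
  simp only [dp, qfact_two_s10, qfact_three, smul_mul_assoc, mul_smul_comm, smul_add, smul_sub,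
    smul_smul]
  rw [show (qint 3 * qint 2)⁻¹ * qint 3 = (qint 2)⁻¹ by field_simp]

end
end
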